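/- Under the Latent Metric Space model with assumptions (A1) and (A3) (rank r), for any ε₁ > 0 and ε₂ ∈ (0, 1/2), on the event A₁(ε₁) ∩ A₂(ε₂) the following three bounds hold: (i) ‖F_* Λ_Y − Λ_Φ F_*‖_F ≤ r^{1/2} [ n (ε₁ + n^{-1}σ²)² / (λ_r^f (1 − 2ε₂)) · (1 + 2 (λ₁^f/λ_r^f)((1+ε₂)/(1−2ε₂))) + n ε₁ + σ² ]; (ii) ‖F_* Λ_Y^{1/2} − Λ_Φ^{1/2} F_*‖_F ≤ ‖F_* Λ_Y − Λ_Φ F_*‖_F / (2 n^{1/2} (1 − ε₂)^{1/2} (λ_r^f)^{1/2}); (iii) ‖F_* Λ_Y^{-1/2} − Λ_Φ^{-1/2} F_*‖_F ≤ ‖F_* Λ_Y^{1/2} − Λ_Φ^{1/2} F_*‖_F / (n (1 − ε₂) λ_r^f). -/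

import Mathlib

open Matrix

/-- Frobenius norm of a real matrix. -/
noncomputable def frobNorm {m n : ℕ} (A : Matrix (Fin m) (Fin n) ℝ) : ℝ :=
  Real.sqrt (∑ i, ∑ j, (A i j) ^ 2)

/-- Spectral norm (ℓ²-operator norm) of a real matrix. -/
noncomputable def specNorm {m n : ℕ} (A : Matrix (Fin m) (Fin n) ℝ) : ℝ :=
  ‖LinearMap.toContinuousLinearMap (Matrix.toEuclideanLin A)‖

/-- The matrix made of the first `r` columns of an `n × n` matrix. -/
def firstCols {n r : ℕ} (h : r ≤ n) (O : Matrix (Fin n) (Fin n) ℝ) :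
    Matrix (Fin n) (Fin r) ℝ :=
  Matrix.of fun i k => O i (Fin.castLE h k)

section Auxiliary

open scoped Matrix.Norms.L2Operator

theorem frobNorm_le_sqrt_mul_l2_opNorm {m n : ℕ} (A : Matrix (Fin m) (Fin n) ℝ) :
    frobNorm A ≤ Real.sqrt n * ‖A‖ := by
  have hcol : ∀ j, ∑ i, A i j ^ 2 ≤ ‖A‖ ^ 2 := by
    intro j
    have h := Matrix.l2_opNorm_mulVec A (EuclideanSpace.single j (1 : ℝ))
    rw [PiLp.norm_single, norm_one, mul_one] at h
    have h' := pow_le_pow_left₀ (norm_nonneg _) h 2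
    rw [EuclideanSpace.real_norm_sq_eq] at h'
    simpa using h'
  rw [frobNorm, Finset.sum_comm]
  refine Real.sqrt_le_iff.2 ⟨by positivity, ?_⟩
  rw [mul_pow, Real.sq_sqrt (Nat.cast_nonneg n)]
  simpa using Finset.sum_le_sum fun j (_ : j ∈ Finset.univ) => hcol j

theorem l2_opNorm_transpose {m n : ℕ} (A : Matrix (Fin m) (Fin n) ℝ) : ‖Aᵀ‖ = ‖A‖ := by
  rw [← Matrix.conjTranspose_eq_transpose_of_trivial, Matrix.l2_opNorm_conjTranspose]

theorem l2_opNorm_diagonal_le {n : ℕ} {d : Fin n → ℝ} {c : ℝ} (hc : 0 ≤ c) (h : ∀ i, |d i| ≤ c) :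
    ‖Matrix.diagonal d‖ ≤ c := by
  rw [Matrix.l2_opNorm_diagonal]
  exact (pi_norm_le_iff_of_nonneg hc).2 h

theorem l2_opNorm_le_one {m n : ℕ} {A : Matrix (Fin m) (Fin n) ℝ} (h : Aᵀ * A = 1) : ‖A‖ ≤ 1 := by
  have h1 := Matrix.l2_opNorm_conjTranspose_mul_self A
  rw [Matrix.conjTranspose_eq_transpose_of_trivial, h, ← Matrix.diagonal_one] at h1
  have h2 : ‖Matrix.diagonal (fun _ : Fin n => (1 : ℝ))‖ ≤ 1 :=
    l2_opNorm_diagonal_le zero_le_one (by simp)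
  nlinarith [norm_nonneg A]

theorem l2_opNorm_mul_mul_le {k l m n : ℕ} {A : Matrix (Fin k) (Fin l) ℝ}
    {C : Matrix (Fin m) (Fin n) ℝ} (hA : ‖A‖ ≤ 1) (hC : ‖C‖ ≤ 1) (B : Matrix (Fin l) (Fin m) ℝ) :
    ‖A * B * C‖ ≤ ‖B‖ :=
  calc ‖A * B * C‖ ≤ ‖A * B‖ * ‖C‖ := Matrix.l2_opNorm_mul _ _
    _ ≤ ‖A * B‖ * 1 := by gcongr
    _ ≤ ‖A‖ * ‖B‖ := by rw [mul_one]; exact Matrix.l2_opNorm_mul _ _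
    _ ≤ 1 * ‖B‖ := by gcongr
    _ = ‖B‖ := one_mul _

theorem mul_diagonal_mul_transpose_mul {n : ℕ} {O : Matrix (Fin n) (Fin n) ℝ} (hO : Oᵀ * O = 1)
    (d e : Fin n → ℝ) :
    O * Matrix.diagonal d * Oᵀ * (O * Matrix.diagonal e * Oᵀ) =
      O * Matrix.diagonal (fun i => d i * e i) * Oᵀ := by
  rw [Matrix.mul_assoc _ Oᵀ, ← Matrix.mul_assoc Oᵀ, ← Matrix.mul_assoc Oᵀ, hO, Matrix.one_mul,
    ← Matrix.mul_assoc, Matrix.mul_assoc O, Matrix.diagonal_mul_diagonal]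

theorem firstCols_eq_mul {n r : ℕ} (h : r ≤ n) (O : Matrix (Fin n) (Fin n) ℝ) :
    firstCols h O = O * firstCols h 1 := by
  ext i k
  simp [firstCols, Matrix.mul_apply, Matrix.one_apply]

theorem diagonal_mul_firstCols_one {n r : ℕ} (h : r ≤ n) (d : Fin n → ℝ) :
    Matrix.diagonal d * firstCols h 1 =
      firstCols h 1 * Matrix.diagonal fun k => d (Fin.castLE h k) := by
  ext i k
  by_cases hik : i = Fin.castLE h k <;> simp [firstCols, Matrix.one_apply, hik]

theorem firstCols_transpose_mul_self {n r : ℕ} (h : r ≤ n) {O : Matrix (Fin n) (Fin n) ℝ}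
    (hO : Oᵀ * O = 1) : (firstCols h O)ᵀ * firstCols h O = 1 := by
  ext i k
  have := congrFun (congrFun hO (Fin.castLE h i)) (Fin.castLE h k)
  simpa [firstCols, Matrix.mul_apply, Matrix.one_apply] using this

theorem firstCols_one_mul_transpose {n r : ℕ} (h : r ≤ n) :
    firstCols h 1 * (firstCols h 1)ᵀ =
      Matrix.diagonal fun i : Fin n => if (i : ℕ) < r then (1 : ℝ) else 0 := by
  ext i j
  simp only [firstCols, Matrix.mul_apply, Matrix.transpose_apply, Matrix.of_apply,
    Matrix.one_apply, Matrix.diagonal_apply]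
  by_cases hi : (i : ℕ) < r
  · rw [Finset.sum_eq_single (⟨i, hi⟩ : Fin r)]
    · simp [hi, Fin.ext_iff, eq_comm]
    · intro k _ hk
      have : i ≠ Fin.castLE h k := fun e => hk (by ext; simp [e])
      simp [this]
    · simp
  · rw [Finset.sum_eq_zero]
    · simp [hi]
    · intro k _
      have : i ≠ Fin.castLE h k := fun e => hi (by rw [e]; exact k.2)
      simp [this]

theorem mul_firstCols_of_eq {n r : ℕ} (h : r ≤ n) {A O : Matrix (Fin n) (Fin n) ℝ}
    {d : Fin n → ℝ} (hO : Oᵀ * O = 1) (hA : A = O * Matrix.diagonal d * Oᵀ) :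
    A * firstCols h O = firstCols h O * Matrix.diagonal fun k => d (Fin.castLE h k) := by
  rw [firstCols_eq_mul, hA, Matrix.mul_assoc O (firstCols h 1), ← diagonal_mul_firstCols_one,
    Matrix.mul_assoc _ Oᵀ, ← Matrix.mul_assoc Oᵀ, hO, Matrix.one_mul, Matrix.mul_assoc]

theorem one_sub_firstCols_mul_transpose {n r : ℕ} (h : r ≤ n) {O : Matrix (Fin n) (Fin n) ℝ}
    (hO : Oᵀ * O = 1) :
    1 - firstCols h O * (firstCols h O)ᵀ =
      O * Matrix.diagonal (fun i : Fin n => if (i : ℕ) < r then (0 : ℝ) else 1) * Oᵀ := by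
  have hO' : O * Oᵀ = 1 := mul_eq_one_comm.1 hO
  have hd : Matrix.diagonal (fun i : Fin n => if (i : ℕ) < r then (0 : ℝ) else 1) =
      1 - Matrix.diagonal fun i : Fin n => if (i : ℕ) < r then (1 : ℝ) else 0 := by
    rw [← Matrix.diagonal_one, Matrix.diagonal_sub]
    congr 1
    ext i
    split_ifs <;> simp
  rw [hd, ← firstCols_one_mul_transpose h, firstCols_eq_mul, Matrix.transpose_mul, Matrix.mul_sub,
    Matrix.sub_mul, Matrix.mul_one, hO']
  simp only [Matrix.mul_assoc]

/-- Eigenvalues of a positive multiple of a Gram matrix are nonnegative. -/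
theorem nonneg_of_smul_mul_transpose_eq {n p : ℕ} {c : ℝ} (hc : 0 ≤ c)
    {Y : Matrix (Fin n) (Fin p) ℝ} {O : Matrix (Fin n) (Fin n) ℝ} {d : Fin n → ℝ}
    (hO : Oᵀ * O = 1) (h : c • (Y * Yᵀ) = O * Matrix.diagonal d * Oᵀ) (i : Fin n) : 0 ≤ d i := by
  have h1 : Matrix.diagonal d = c • ((Oᵀ * Y) * (Oᵀ * Y)ᵀ) := by
    have : Oᵀ * (c • (Y * Yᵀ)) * O = Matrix.diagonal d := by
      rw [h, Matrix.mul_assoc, Matrix.mul_assoc _ Oᵀ, hO, Matrix.mul_one, ← Matrix.mul_assoc, hO,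
        Matrix.one_mul]
    rw [← this, Matrix.transpose_mul, Matrix.transpose_transpose, Matrix.mul_smul, Matrix.smul_mul]
    simp only [Matrix.mul_assoc]
  have h2 := congrFun (congrFun h1 i) i
  rw [Matrix.diagonal_apply_eq, Matrix.smul_apply, Matrix.mul_apply] at h2
  rw [h2]
  exact mul_nonneg hc (Finset.sum_nonneg fun j _ => mul_self_nonneg _)

/-- A Davis–Kahan bound: if `V` spans an invariant subspace of `B` with eigenvalues at least `a`,
and the projection `P` reduces `A` with `‖A * P‖ ≤ b < a`, then `‖Vᵀ * P‖ ≤ ‖A - B‖ / (a - b)`. -/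
theorem l2_opNorm_transpose_mul_le_of_gap {n r : ℕ} {A B P : Matrix (Fin n) (Fin n) ℝ}
    {V : Matrix (Fin n) (Fin r) ℝ} {d : Fin r → ℝ} {a b : ℝ} (hb : 0 ≤ b) (hab : b < a)
    (hV : Vᵀ * V = 1) (hVB : Vᵀ * B = Matrix.diagonal d * Vᵀ) (hd : ∀ k, a ≤ d k)
    (hPn : ‖P‖ ≤ 1) (hAP : A * P = P * (A * P)) (hAPn : ‖A * P‖ ≤ b) :
    ‖Vᵀ * P‖ ≤ ‖A - B‖ / (a - b) := by
  have ha : 0 < a := hb.trans_lt hab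
  have hVn : ‖Vᵀ‖ ≤ 1 := by rw [l2_opNorm_transpose]; exact l2_opNorm_le_one hV
  have hdpos : ∀ k, 0 < d k := fun k => ha.trans_le (hd k)
  have hX : Matrix.diagonal d * (Vᵀ * P) = Vᵀ * P * (A * P) - Vᵀ * (A - B) * P := by
    rw [← Matrix.mul_assoc, ← hVB, Matrix.mul_assoc Vᵀ P, ← hAP, Matrix.mul_sub, Matrix.sub_mul,
      Matrix.mul_assoc Vᵀ A, sub_sub_cancel]
  have hinv : Vᵀ * P = Matrix.diagonal (fun k => (d k)⁻¹) * (Matrix.diagonal d * (Vᵀ * P)) := by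
    rw [← Matrix.mul_assoc, Matrix.diagonal_mul_diagonal]
    simp [inv_mul_cancel₀ (hdpos _).ne']
  have hdinv : ‖Matrix.diagonal (fun k => (d k)⁻¹)‖ ≤ a⁻¹ := by
    refine l2_opNorm_diagonal_le (by positivity) fun k => ?_
    rw [abs_of_pos (inv_pos.2 (hdpos k))]
    exact inv_anti₀ ha (hd k)
  have hle : ‖Vᵀ * P‖ ≤ a⁻¹ * (‖Vᵀ * P‖ * b + ‖A - B‖) :=
    calc ‖Vᵀ * P‖ ≤ ‖Matrix.diagonal (fun k => (d k)⁻¹)‖ * ‖Matrix.diagonal d * (Vᵀ * P)‖ := by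
          conv_lhs => rw [hinv]
          exact Matrix.l2_opNorm_mul _ _
      _ ≤ a⁻¹ * (‖Vᵀ * P‖ * b + ‖A - B‖) := by
          gcongr
          rw [hX]
          refine (norm_sub_le _ _).trans (add_le_add ?_ (l2_opNorm_mul_mul_le hVn hPn _))
          exact (Matrix.l2_opNorm_mul _ _).trans (by gcongr)
  rw [le_div_iff₀ (sub_pos.2 hab)]
  rw [inv_mul_eq_div, le_div_iff₀ ha] at hle
  linarith

/-- The orthogonal polar factor of a matrix `M` with singular values `s` is within
`‖1 - M * Mᵀ‖` of `M`, provided `1 - M * Mᵀ` is a Gram matrix `X * Xᵀ`. -/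
theorem l2_opNorm_polar_sub_le {n r : ℕ} {M F₁ F₂ : Matrix (Fin r) (Fin r) ℝ} {s : Fin r → ℝ}
    {X : Matrix (Fin r) (Fin n) ℝ}
    (hF₁ : F₁ᵀ * F₁ = 1) (hF₂ : F₂ᵀ * F₂ = 1) (hs : ∀ k, 0 ≤ s k)
    (hM : M = F₁ * Matrix.diagonal s * F₂ᵀ) (hX : X * Xᵀ = 1 - M * Mᵀ) :
    ‖F₁ * F₂ᵀ - M‖ ≤ ‖X‖ ^ 2 := by
  have hdiag : F₁ᵀ * X * (F₁ᵀ * X)ᵀ = Matrix.diagonal fun k => 1 - s k ^ 2 := by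
    have hMM : M * Mᵀ = F₁ * Matrix.diagonal (fun k => s k ^ 2) * F₁ᵀ := by
      rw [hM, Matrix.transpose_mul, Matrix.transpose_mul, Matrix.transpose_transpose,
        Matrix.diagonal_transpose, Matrix.mul_assoc, ← Matrix.mul_assoc F₂ᵀ, hF₂, Matrix.one_mul,
        Matrix.mul_assoc F₁, ← Matrix.mul_assoc (Matrix.diagonal s), Matrix.diagonal_mul_diagonal,
        ← Matrix.mul_assoc]
      simp only [sq]
    rw [Matrix.transpose_mul, Matrix.transpose_transpose, Matrix.mul_assoc, ← Matrix.mul_assoc X,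
      hX, hMM, Matrix.sub_mul, Matrix.mul_sub, Matrix.one_mul, hF₁, Matrix.mul_assoc _ F₁ᵀ, hF₁,
      Matrix.mul_one, ← Matrix.mul_assoc, hF₁, Matrix.one_mul, ← Matrix.diagonal_one,
      Matrix.diagonal_sub]
  have hnn : ∀ k, 0 ≤ 1 - s k ^ 2 :=
    nonneg_of_smul_mul_transpose_eq (c := 1) (Y := F₁ᵀ * X) (O := 1) zero_le_one (by simp)
      (by simpa using hdiag)
  have hF₁n : ‖F₁‖ ≤ 1 := l2_opNorm_le_one hF₁
  have hF₁tn : ‖F₁ᵀ‖ ≤ 1 := by rwa [l2_opNorm_transpose]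
  have hF₂n : ‖F₂ᵀ‖ ≤ 1 := by rw [l2_opNorm_transpose]; exact l2_opNorm_le_one hF₂
  have hnorm : ‖Matrix.diagonal fun k => 1 - s k ^ 2‖ ≤ ‖X‖ ^ 2 := by
    have hXn : ‖F₁ᵀ * X‖ ≤ ‖X‖ :=
      (Matrix.l2_opNorm_mul _ _).trans (mul_le_of_le_one_left (norm_nonneg _) hF₁tn)
    rw [← hdiag, sq]
    refine (Matrix.l2_opNorm_mul _ _).trans ?_
    rw [l2_opNorm_transpose]
    gcongr
  have hk : ∀ k, |1 - s k| ≤ ‖X‖ ^ 2 := by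
    intro k
    rw [Matrix.l2_opNorm_diagonal] at hnorm
    have h1 := (norm_le_pi_norm (fun k => 1 - s k ^ 2) k).trans hnorm
    rw [Real.norm_of_nonneg (hnn k)] at h1
    have hs1 : s k ≤ 1 := by nlinarith [hnn k, hs k]
    rw [abs_of_nonneg (sub_nonneg.2 hs1)]
    nlinarith [hs k]
  have hsub : F₁ * F₂ᵀ - M = F₁ * Matrix.diagonal (fun k => 1 - s k) * F₂ᵀ := by
    rw [hM, ← Matrix.diagonal_sub, Matrix.diagonal_one, Matrix.mul_sub, Matrix.sub_mul,
      Matrix.mul_one]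
  rw [hsub]
  exact (l2_opNorm_mul_mul_le hF₁n hF₂n _).trans (l2_opNorm_diagonal_le (by positivity) hk)

/-- Commuting the polar factor `F₁ * F₂ᵀ` of the overlap of two leading eigenbases past the
eigenvalue matrices, when the eigenvalues are separated by the gap `a - b`. -/
theorem l2_opNorm_polar_comm_le {n r : ℕ} (h : r ≤ n)
    {A B OA OB : Matrix (Fin n) (Fin n) ℝ} {ν ρ : Fin n → ℝ}
    {F₁ F₂ : Matrix (Fin r) (Fin r) ℝ} {s : Fin r → ℝ} {a b c δ : ℝ}
    (hOA : OAᵀ * OA = 1) (hA : A = OA * Matrix.diagonal ν * OAᵀ)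
    (hOB : OBᵀ * OB = 1) (hB : B = OB * Matrix.diagonal ρ * OBᵀ)
    (hF₁ : F₁ᵀ * F₁ = 1) (hF₂ : F₂ᵀ * F₂ = 1) (hs : ∀ k, 0 ≤ s k)
    (hSVD : (firstCols h OB)ᵀ * firstCols h OA = F₁ * Matrix.diagonal s * F₂ᵀ)
    (hb : 0 ≤ b) (hab : b < a) (hc : 0 ≤ c) (hδ : ‖A - B‖ ≤ δ)
    (hνc : ∀ k : Fin r, |ν (Fin.castLE h k)| ≤ c) (hρc : ∀ k : Fin r, |ρ (Fin.castLE h k)| ≤ c)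
    (hρa : ∀ k : Fin r, a ≤ ρ (Fin.castLE h k)) (hνb : ∀ i : Fin n, r ≤ (i : ℕ) → |ν i| ≤ b) :
    ‖F₁ * F₂ᵀ * Matrix.diagonal (fun k => ν (Fin.castLE h k))
        - Matrix.diagonal (fun k => ρ (Fin.castLE h k)) * (F₁ * F₂ᵀ)‖
      ≤ 2 * c * (δ / (a - b)) ^ 2 + δ := by
  set U := firstCols h OA
  set V := firstCols h OB
  set ΛA := Matrix.diagonal fun k => ν (Fin.castLE h k)
  set ΛB := Matrix.diagonal fun k => ρ (Fin.castLE h k)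
  have hUU : Uᵀ * U = 1 := firstCols_transpose_mul_self h hOA
  have hVV : Vᵀ * V = 1 := firstCols_transpose_mul_self h hOB
  have hOAn : ‖OA‖ ≤ 1 := l2_opNorm_le_one hOA
  have hOAtn : ‖OAᵀ‖ ≤ 1 := by rwa [l2_opNorm_transpose]
  have hAU : A * U = U * ΛA := mul_firstCols_of_eq h hOA hA
  have hBt : Bᵀ = B := by
    rw [hB]
    simp [Matrix.transpose_mul, Matrix.mul_assoc]
  have hVB : Vᵀ * B = ΛB * Vᵀ := by
    have := congrArg Matrix.transpose (mul_firstCols_of_eq h hOB hB)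
    rwa [Matrix.transpose_mul, Matrix.transpose_mul, hBt, Matrix.diagonal_transpose] at this
  set P := 1 - U * Uᵀ with hP
  have hPd : P = OA * Matrix.diagonal (fun i : Fin n => if (i : ℕ) < r then (0 : ℝ) else 1) * OAᵀ :=
    one_sub_firstCols_mul_transpose h hOA
  have hPn : ‖P‖ ≤ 1 := by
    rw [hPd]
    refine (l2_opNorm_mul_mul_le hOAn hOAtn _).trans (l2_opNorm_diagonal_le zero_le_one fun i => ?_)
    split_ifs <;> simp
  have hAPd : A * P =
      OA * Matrix.diagonal (fun i : Fin n => if (i : ℕ) < r then 0 else ν i) * OAᵀ := by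
    rw [hA, hPd, mul_diagonal_mul_transpose_mul hOA]
    simp
  have hAPn : ‖A * P‖ ≤ b := by
    rw [hAPd]
    refine (l2_opNorm_mul_mul_le hOAn hOAtn _).trans (l2_opNorm_diagonal_le hb fun i => ?_)
    split_ifs with hi
    · simpa using hb
    · exact hνb i (not_lt.1 hi)
  have hAP : A * P = P * (A * P) := by
    rw [hAPd, hPd, mul_diagonal_mul_transpose_mul hOA]
    congr 3
    ext i
    split_ifs <;> simp
  have hsin : ‖Vᵀ * P‖ ≤ δ / (a - b) :=
    (l2_opNorm_transpose_mul_le_of_gap hb hab hVV hVB hρa hPn hAP hAPn).trans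
      (div_le_div_of_nonneg_right hδ (sub_pos.2 hab).le)
  have hPP : P * Pᵀ = P := by
    have hPt : Pᵀ = P := by rw [hP]; simp
    rw [hPt, hP, Matrix.mul_sub, Matrix.mul_one, Matrix.sub_mul, Matrix.one_mul,
      Matrix.mul_assoc U, ← Matrix.mul_assoc Uᵀ, hUU, Matrix.one_mul, sub_self, sub_zero]
  have hX : Vᵀ * P * (Vᵀ * P)ᵀ = 1 - Vᵀ * U * (Vᵀ * U)ᵀ := by
    rw [Matrix.transpose_mul, Matrix.mul_assoc, ← Matrix.mul_assoc P, hPP, hP]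
    simp only [Matrix.transpose_mul, Matrix.transpose_transpose, Matrix.mul_sub, Matrix.sub_mul,
      Matrix.one_mul, hVV, Matrix.mul_assoc]
  have hpolar : ‖F₁ * F₂ᵀ - Vᵀ * U‖ ≤ (δ / (a - b)) ^ 2 :=
    (l2_opNorm_polar_sub_le hF₁ hF₂ hs hSVD hX).trans (pow_le_pow_left₀ (norm_nonneg _) hsin 2)
  have hdecomp : F₁ * F₂ᵀ * ΛA - ΛB * (F₁ * F₂ᵀ) =
      (F₁ * F₂ᵀ - Vᵀ * U) * ΛA - ΛB * (F₁ * F₂ᵀ - Vᵀ * U) + Vᵀ * (A - B) * U := by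
    have h1 : Vᵀ * (A - B) * U = Vᵀ * U * ΛA - ΛB * (Vᵀ * U) := by
      rw [Matrix.mul_sub, Matrix.sub_mul, hVB, Matrix.mul_assoc, hAU, Matrix.mul_assoc ΛB,
        Matrix.mul_assoc]
    rw [h1, Matrix.sub_mul, Matrix.mul_sub]
    abel
  have hΛA : ‖ΛA‖ ≤ c := l2_opNorm_diagonal_le hc hνc
  have hΛB : ‖ΛB‖ ≤ c := l2_opNorm_diagonal_le hc hρc
  have hVn : ‖Vᵀ‖ ≤ 1 := by rw [l2_opNorm_transpose]; exact l2_opNorm_le_one hVV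
  rw [hdecomp]
  calc _ ≤ ‖F₁ * F₂ᵀ - Vᵀ * U‖ * ‖ΛA‖ + ‖ΛB‖ * ‖F₁ * F₂ᵀ - Vᵀ * U‖ + ‖A - B‖ :=
        (norm_add_le _ _).trans (add_le_add ((norm_sub_le _ _).trans
          (add_le_add (Matrix.l2_opNorm_mul _ _) (Matrix.l2_opNorm_mul _ _)))
          (l2_opNorm_mul_mul_le hVn (l2_opNorm_le_one hUU) _))
    _ ≤ (δ / (a - b)) ^ 2 * c + c * (δ / (a - b)) ^ 2 + δ := by gcongr
    _ = _ := by ring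

theorem l2_opNorm_le_add_of_sub_smul_one {n : ℕ} {D : Matrix (Fin n) (Fin n) ℝ} {t c : ℝ}
    (ht : 0 ≤ t) (h : ‖D - t • (1 : Matrix (Fin n) (Fin n) ℝ)‖ ≤ c) : ‖D‖ ≤ c + t := by
  have h1 : ‖(1 : Matrix (Fin n) (Fin n) ℝ)‖ ≤ 1 := l2_opNorm_le_one (by simp)
  calc ‖D‖ = ‖D - t • (1 : Matrix (Fin n) (Fin n) ℝ) + t • (1 : Matrix (Fin n) (Fin n) ℝ)‖ := by
        rw [sub_add_cancel]
    _ ≤ c + t * 1 := by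
        refine (norm_add_le _ _).trans (add_le_add h ?_)
        rw [norm_smul, Real.norm_of_nonneg ht]
        gcongr
    _ = c + t := by rw [mul_one]

end Auxiliary

/-- Entrywise comparison of the commutators of `F` with two pairs of diagonal matrices. -/
theorem frobNorm_comm_diagonal_le_div {r : ℕ} (F : Matrix (Fin r) (Fin r) ℝ)
    {x y x' y' : Fin r → ℝ} {c : ℝ} (hc : 0 < c)
    (h : ∀ i j, |x j - y i| * c ≤ |x' j - y' i|) :
    frobNorm (F * Matrix.diagonal x - Matrix.diagonal y * F) ≤
      frobNorm (F * Matrix.diagonal x' - Matrix.diagonal y' * F) / c := by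
  rw [le_div_iff₀ hc, frobNorm, frobNorm, ← Real.sqrt_sq hc.le, ← Real.sqrt_mul (by positivity),
    Finset.sum_mul]
  refine Real.sqrt_le_sqrt (Finset.sum_le_sum fun i _ => ?_)
  rw [Finset.sum_mul]
  refine Finset.sum_le_sum fun j _ => ?_
  simp only [Matrix.sub_apply, Matrix.mul_diagonal, Matrix.diagonal_mul]
  have h2 := pow_le_pow_left₀ (by positivity) (h i j) 2
  rw [mul_pow, sq_abs, sq_abs] at h2
  calc (F i j * x j - y i * F i j) ^ 2 * c ^ 2 = F i j ^ 2 * ((x j - y i) ^ 2 * c ^ 2) := by ring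
    _ ≤ F i j ^ 2 * (x' j - y' i) ^ 2 := by gcongr
    _ = (F i j * x' j - y' i * F i j) ^ 2 := by ring

theorem abs_sqrt_sub_sqrt_mul_le {x y m : ℝ} (hm : 0 ≤ m) (hx : m ≤ x) (hy : m ≤ y) :
    |√x - √y| * (2 * √m) ≤ |x - y| := by
  have hxy : x - y = (√x - √y) * (√x + √y) := by
    linear_combination -Real.sq_sqrt (hm.trans hx) + Real.sq_sqrt (hm.trans hy)
  rw [hxy, abs_mul, abs_of_nonneg (by positivity : 0 ≤ √x + √y)]
  gcongr
  linarith [Real.sqrt_le_sqrt hx, Real.sqrt_le_sqrt hy]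

theorem abs_inv_sqrt_sub_inv_sqrt_mul_le {x y m : ℝ} (hm : 0 < m) (hx : m ≤ x) (hy : m ≤ y) :
    |(√x)⁻¹ - (√y)⁻¹| * m ≤ |√x - √y| := by
  have hx' : 0 < √x := Real.sqrt_pos.2 (hm.trans_le hx)
  have hy' : 0 < √y := Real.sqrt_pos.2 (hm.trans_le hy)
  rw [inv_sub_inv hx'.ne' hy'.ne', abs_div, abs_of_pos (mul_pos hx' hy'), div_mul_eq_mul_div,
    div_le_iff₀ (mul_pos hx' hy'), abs_sub_comm]
  gcongr
  calc m = √m * √m := (Real.mul_self_sqrt hm.le).symm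
    _ ≤ √x * √y := by gcongr

/-- Under the Latent Metric Space model with (A1) and (A3),
on the event `A₁(ε₁) ∩ A₂(ε₂)` the three Frobenius-norm bounds of Lemma
`lem:order_swtich` hold for `F⋆ := F₁ F₂ᵀ`, `Λ_Y`, `Λ_Φ`. -/
theorem order_switch_bounds {n p r : ℕ}
    (hp : 0 < p) (hn : 0 < n) (hr0 : 0 < r) (hrn : r ≤ n)
    (Y : Matrix (Fin n) (Fin p) ℝ) (Φ : Matrix (Fin n) (Fin r) ℝ) (σ : ℝ)
    (lam : Fin r → ℝ) (hlam_pos : ∀ k, 0 < lam k) (hlam_mono : Antitone lam)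
    -- full sorted eigendecomposition of `p⁻¹ • (Y Yᵀ)`
    (OY : Matrix (Fin n) (Fin n) ℝ) (ν : Fin n → ℝ)
    (hOY : OYᵀ * OY = 1)
    (hYdec : (p : ℝ)⁻¹ • (Y * Yᵀ) = OY * Matrix.diagonal ν * OYᵀ)
    (hν : Antitone ν)
    -- full sorted eigendecomposition of `Φ Φᵀ`
    (OΦ : Matrix (Fin n) (Fin n) ℝ) (ρ : Fin n → ℝ)
    (hOΦ : OΦᵀ * OΦ = 1)
    (hΦdec : Φ * Φᵀ = OΦ * Matrix.diagonal ρ * OΦᵀ)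
    (hρ : Antitone ρ)
    -- full singular value decomposition of `U_Φᵀ U_Y`, and `F⋆ := F₁ F₂ᵀ`
    (F₁ F₂ : Matrix (Fin r) (Fin r) ℝ) (s : Fin r → ℝ)
    (hF₁ : F₁ᵀ * F₁ = 1 ∧ F₁ * F₁ᵀ = 1) (hF₂ : F₂ᵀ * F₂ = 1 ∧ F₂ * F₂ᵀ = 1)
    (hs : ∀ k, 0 ≤ s k)
    (hSVD : (firstCols hrn OΦ)ᵀ * firstCols hrn OY = F₁ * Matrix.diagonal s * F₂ᵀ)
    (ε₁ ε₂ : ℝ) (hε₁ : 0 < ε₁) (hε₂ : 0 < ε₂) (hε₂' : ε₂ < 1/2)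
    -- the event A₁(ε₁)
    (hA1 : specNorm ((p : ℝ)⁻¹ • (Y * Yᵀ) - Φ * Φᵀ
        - σ ^ 2 • (1 : Matrix (Fin n) (Fin n) ℝ)) ≤ ε₁ * n)
    -- the event A₂(ε₂)
    (hA2Y : ∀ k : Fin r,
      lam k * (1 - ε₂) ≤ (n : ℝ)⁻¹ * ν (Fin.castLE hrn k) ∧
      (n : ℝ)⁻¹ * ν (Fin.castLE hrn k) ≤ lam k * (1 + ε₂))
    (hA2Y' : ∀ i : Fin n, r ≤ (i : ℕ) →
      (n : ℝ)⁻¹ * ν i ≤ ε₂ * lam ⟨r - 1, Nat.sub_lt hr0 one_pos⟩)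
    (hA2Φ : ∀ k : Fin r,
      (1 - ε₂) * lam k ≤ (n : ℝ)⁻¹ * ρ (Fin.castLE hrn k) ∧
      (n : ℝ)⁻¹ * ρ (Fin.castLE hrn k) ≤ (1 + ε₂) * lam k) :
    -- (i)
    frobNorm (F₁ * F₂ᵀ * Matrix.diagonal (fun k => ν (Fin.castLE hrn k))
        - Matrix.diagonal (fun k => ρ (Fin.castLE hrn k)) * (F₁ * F₂ᵀ))
      ≤ Real.sqrt r *
        ((n : ℝ) * (ε₁ + (n : ℝ)⁻¹ * σ ^ 2) ^ 2
            / (lam ⟨r - 1, Nat.sub_lt hr0 one_pos⟩ * (1 - 2 * ε₂)) *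
          (1 + 2 * (lam ⟨0, hr0⟩ / lam ⟨r - 1, Nat.sub_lt hr0 one_pos⟩)
              * ((1 + ε₂) / (1 - 2 * ε₂)))
          + (n : ℝ) * ε₁ + σ ^ 2) ∧
    -- (ii)
    frobNorm (F₁ * F₂ᵀ * Matrix.diagonal (fun k => Real.sqrt (ν (Fin.castLE hrn k)))
        - Matrix.diagonal (fun k => Real.sqrt (ρ (Fin.castLE hrn k))) * (F₁ * F₂ᵀ))
      ≤ frobNorm (F₁ * F₂ᵀ * Matrix.diagonal (fun k => ν (Fin.castLE hrn k))
            - Matrix.diagonal (fun k => ρ (Fin.castLE hrn k)) * (F₁ * F₂ᵀ))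
          / (2 * Real.sqrt n * Real.sqrt (1 - ε₂)
              * Real.sqrt (lam ⟨r - 1, Nat.sub_lt hr0 one_pos⟩)) ∧
    -- (iii)
    frobNorm (F₁ * F₂ᵀ * Matrix.diagonal (fun k => (Real.sqrt (ν (Fin.castLE hrn k)))⁻¹)
        - Matrix.diagonal (fun k => (Real.sqrt (ρ (Fin.castLE hrn k)))⁻¹) * (F₁ * F₂ᵀ))
      ≤ frobNorm (F₁ * F₂ᵀ * Matrix.diagonal (fun k => Real.sqrt (ν (Fin.castLE hrn k)))
            - Matrix.diagonal (fun k => Real.sqrt (ρ (Fin.castLE hrn k))) * (F₁ * F₂ᵀ))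
          / ((n : ℝ) * (1 - ε₂) * lam ⟨r - 1, Nat.sub_lt hr0 one_pos⟩) := by
  have hn' : (0 : ℝ) < n := Nat.cast_pos.2 hn
  set l := lam ⟨r - 1, Nat.sub_lt hr0 one_pos⟩
  set L := lam ⟨0, hr0⟩
  have hl : 0 < l := hlam_pos _
  have hL : 0 < L := hlam_pos _
  have hl_le : ∀ k, l ≤ lam k := fun k => hlam_mono (Fin.mk_le_mk.2 (Nat.le_sub_one_of_lt k.2))
  have hle_L : ∀ k, lam k ≤ L := fun k => hlam_mono (Fin.mk_le_mk.2 (Nat.zero_le _))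
  have hm : 0 < n * (1 - ε₂) * l := mul_pos (mul_pos hn' (by linarith)) hl
  have lower : ∀ {x : ℝ} {k}, (1 - ε₂) * lam k ≤ (n : ℝ)⁻¹ * x → n * (1 - ε₂) * l ≤ x := by
    intro x k hx
    rw [inv_mul_eq_div, le_div_iff₀ hn'] at hx
    calc n * (1 - ε₂) * l ≤ n * (1 - ε₂) * lam k := by
          have : 0 ≤ 1 - ε₂ := by linarith
          gcongr
          exact hl_le k
      _ ≤ x := by linarith
  have upper : ∀ {x : ℝ} {k}, (n : ℝ)⁻¹ * x ≤ (1 + ε₂) * lam k → x ≤ n * (1 + ε₂) * L := by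
    intro x k hx
    rw [inv_mul_eq_div, div_le_iff₀ hn'] at hx
    calc x ≤ n * (1 + ε₂) * lam k := by linarith
      _ ≤ n * (1 + ε₂) * L := by
          gcongr
          exact hle_L k
  have hν_lower : ∀ k : Fin r, n * (1 - ε₂) * l ≤ ν (Fin.castLE hrn k) := fun k =>
    lower ((mul_comm _ _).trans_le (hA2Y k).1)
  have hρ_lower : ∀ k : Fin r, n * (1 - ε₂) * l ≤ ρ (Fin.castLE hrn k) := fun k =>
    lower (hA2Φ k).1
  have hν_upper : ∀ k : Fin r, ν (Fin.castLE hrn k) ≤ n * (1 + ε₂) * L := fun k =>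
    upper ((hA2Y k).2.trans_eq (mul_comm _ _))
  have hρ_upper : ∀ k : Fin r, ρ (Fin.castLE hrn k) ≤ n * (1 + ε₂) * L := fun k =>
    upper (hA2Φ k).2
  refine ⟨?_, ?_, ?_⟩
  · have hδ := l2_opNorm_le_add_of_sub_smul_one (sq_nonneg σ) hA1
    have key := l2_opNorm_polar_comm_le hrn (a := n * (1 - ε₂) * l) (b := n * ε₂ * l)
      (c := n * (1 + ε₂) * L) hOY hYdec hOΦ hΦdec hF₁.1 hF₂.1 hs hSVD (by positivity)
      (by gcongr; linarith) (by positivity) hδ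
      (fun k => by rw [abs_of_pos (hm.trans_le (hν_lower k))]; exact hν_upper k)
      (fun k => by rw [abs_of_pos (hm.trans_le (hρ_lower k))]; exact hρ_upper k) hρ_lower
      (fun i hi => by
        rw [abs_of_nonneg (nonneg_of_smul_mul_transpose_eq (by positivity) hOY hYdec i)]
        have := hA2Y' i hi
        rw [inv_mul_eq_div, div_le_iff₀ hn'] at this
        linarith)
    refine (frobNorm_le_sqrt_mul_l2_opNorm _).trans
      (mul_le_mul_of_nonneg_left (key.trans ?_) (Real.sqrt_nonneg _))
    have hg : 0 < 1 - 2 * ε₂ := by linarith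
    have heq : 2 * (n * (1 + ε₂) * L) *
        ((ε₁ * n + σ ^ 2) / (n * (1 - ε₂) * l - n * ε₂ * l)) ^ 2 =
        n * (ε₁ + (n : ℝ)⁻¹ * σ ^ 2) ^ 2 / (l * (1 - 2 * ε₂)) *
          (2 * (L / l) * ((1 + ε₂) / (1 - 2 * ε₂))) := by
      have h1 : n * (1 - ε₂) * l - n * ε₂ * l = n * (l * (1 - 2 * ε₂)) := by ring
      have h2 : ε₁ * n + σ ^ 2 = n * (ε₁ + (n : ℝ)⁻¹ * σ ^ 2) := by field_simp
      rw [h1, h2, mul_div_mul_left _ _ hn'.ne']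
      field_simp
    have hpos : 0 ≤ n * (ε₁ + (n : ℝ)⁻¹ * σ ^ 2) ^ 2 / (l * (1 - 2 * ε₂)) := by positivity
    rw [heq, mul_add, mul_one]
    linarith
  · have hsqrt : 2 * √(n : ℝ) * √(1 - ε₂) * √l = 2 * √(n * (1 - ε₂) * l) := by
      rw [Real.sqrt_mul' _ hl.le, Real.sqrt_mul hn'.le]
      ring
    rw [hsqrt]
    exact frobNorm_comm_diagonal_le_div _ (by positivity) fun i j =>
      abs_sqrt_sub_sqrt_mul_le hm.le (hν_lower j) (hρ_lower i)
  · exact frobNorm_comm_diagonal_le_div _ hm fun i j =>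
      abs_inv_sqrt_sub_inv_sqrt_mul_le hm (hν_lower j) (hρ_lower i)
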